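/- Let n ≥ 1 be a natural number and let U : ℕ → ℕ → ℤ satisfy U_r(0) = 1 for all r and U_r(k) = (n - r - k)·U_r(k-1) - 2·(n - 2r - δ(n-1))·U_{r+1}(k-1) whenever k ≥ 1 and r + k ≤ ⌊n/2⌋. Then U_0(⌊n/2⌋) = c · ∏_{j=1}^{⌊n/2⌋}(n - j), where c = 2 if n ≡ 0 (mod 6), c = 1 if n ≡ 1 or 5 (mod 6), c = -1 if n ≡ 2 or 4 (mod 6), and c = -2 if n ≡ 3 (mod 6). -/

import Mathlib

/-- A triangular recursion whose first coefficient depends only on `r + k` and whose second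
coefficient depends only on `r` has a binomial closed form. -/
lemma eq_sum_antidiagonal_choose_of_recurrence (f g : ℕ → ℤ) (U : ℕ → ℕ → ℤ) (m : ℕ)
    (hU0 : ∀ r, U r 0 = 1)
    (hU : ∀ r k, r + k + 1 ≤ m → U r (k + 1) = f (r + k + 1) * U r k + g r * U (r + 1) k) :
    ∀ k r, r + k ≤ m → U r k = ∑ p ∈ Finset.HasAntidiagonal.antidiagonal k, (k.choose p.1 : ℤ) *
      ((∏ i ∈ Finset.range p.1, g (r + i)) * ∏ i ∈ Finset.range p.2, f (r + k - i)) := by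
  intro k
  induction k with
  | zero => intro r _; simp [hU0]
  | succ k ih =>
    intro r hr
    rw [hU r k (by omega), ih r (by omega), ih (r + 1) (by omega),
      Finset.sum_antidiagonal_choose_succ_mul
        (fun a b => (∏ i ∈ Finset.range a, g (r + i)) * ∏ i ∈ Finset.range b, f (r + (k + 1) - i)),
      Finset.mul_sum, Finset.mul_sum]
    congr 1
    · refine Finset.sum_congr rfl fun p _ => ?_
      rw [Finset.prod_range_succ' _ p.2]
      have h : ∀ i, r + (k + 1) - (i + 1) = r + k - i := fun i => by omega
      simp only [h, Nat.sub_zero, add_assoc]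
      ring
    · refine Finset.sum_congr rfl fun p hp => ?_
      have hp' := Finset.HasAntidiagonal.mem_antidiagonal.1 hp
      rw [Finset.prod_range_succ' _ p.1, ← Nat.choose_symm_of_eq_add hp'.symm]
      have h : ∀ i, r + 1 + i = r + (i + 1) := fun i => by omega
      simp only [h, add_zero]
      ring

/-- The number of `j`-matchings of the cycle of length `n`, for `2 * j ≤ n`. -/
def cycleMatchingCount : ℕ → ℕ → ℕ
  | _, 0 => 1
  | n, j + 1 => (n - (j + 1)).choose (j + 1) + (n - (j + 2)).choose j

lemma factorial_mul_cycleMatchingCount_mul_descFactorial (n j : ℕ) (h : 2 * j ≤ n) :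
    j.factorial * cycleMatchingCount n j * (n - 1).descFactorial j = n.descFactorial (2 * j) := by
  cases j with
  | zero => simp [cycleMatchingCount]
  | succ j =>
    obtain ⟨q, rfl⟩ : ∃ q, n = q + j + 2 := ⟨n - (j + 2), by omega⟩
    have h1 : q + j + 2 - (j + 1) = q + 1 := by omega
    have h2 : q + j + 2 - (j + 2) = q := by omega
    have h3 : (j + 1).factorial * cycleMatchingCount (q + j + 2) (j + 1)
        = (q + j + 2) * q.descFactorial j := by
      rw [cycleMatchingCount, h1, h2, mul_add, ← Nat.descFactorial_eq_factorial_mul_choose,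
        Nat.succ_descFactorial_succ, Nat.factorial_succ, mul_assoc,
        ← Nat.descFactorial_eq_factorial_mul_choose]
      ring
    have h4 : (q + j + 1).descFactorial (2 * j + 1)
        = q.descFactorial j * (q + j + 1).descFactorial (j + 1) := by
      rw [← Nat.descFactorial_mul_descFactorial (k := j + 1) (m := 2 * j + 1) (by omega)]
      congr 2 <;> omega
    rw [h3, show 2 * (j + 1) = (2 * j + 1) + 1 by ring, Nat.succ_descFactorial_succ, h4,
      show q + j + 2 - 1 = q + j + 1 by omega, mul_assoc]

lemma descFactorial_half_mul_prod (n j : ℕ) (hn : 1 ≤ n) (hj : j ≤ n / 2) :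
    ((n / 2).descFactorial j : ℤ)
      * ∏ i ∈ Finset.range j, (2 * ((n : ℤ) - 2 * i - ((n - 1) % 2 : ℕ)))
      = n.descFactorial (2 * j) := by
  induction j with
  | zero => simp
  | succ j ih =>
    have ih := ih (by omega)
    rw [show 2 * (j + 1) = 2 * j + 1 + 1 by ring, Nat.descFactorial_succ, Nat.descFactorial_succ,
      Nat.descFactorial_succ, Finset.prod_range_succ]
    push_cast [Nat.cast_sub (show j ≤ n / 2 by omega),
      Nat.cast_sub (show 2 * j ≤ n by omega), Nat.cast_sub (show 2 * j + 1 ≤ n by omega)]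
    have key : ((n / 2 : ℕ) - (j : ℤ)) * (2 * ((n : ℤ) - 2 * j - ((n - 1) % 2 : ℕ)))
        = ((n : ℤ) - (2 * j + 1)) * (n - 2 * j) := by
      rcases Nat.even_or_odd' n with ⟨m, rfl | rfl⟩
      · rw [show (2 * m - 1) % 2 = 1 by omega, show 2 * m / 2 = m by omega]
        push_cast; ring
      · rw [show (2 * m + 1 - 1) % 2 = 0 by omega, show (2 * m + 1) / 2 = m by omega]
        push_cast; ring
    push_cast at key ih
    linear_combination ((n / 2 : ℤ) - j) * (2 * ((n : ℤ) - 2 * j - ((n - 1 : ℕ) : ℤ) % 2)) * ih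
      + (n.descFactorial (2 * j) : ℤ) * key

lemma cast_descFactorial_pred (n j : ℕ) (h : j < n) :
    ((n - 1).descFactorial j : ℤ) = ∏ l ∈ Finset.range j, ((n : ℤ) - 1 - l) := by
  rw [Nat.descFactorial_eq_prod_range, Nat.cast_prod]
  refine Finset.prod_congr rfl fun l hl => ?_
  have := Finset.mem_range.1 hl
  omega

lemma choose_half_mul_prod (n j : ℕ) (hn : 1 ≤ n) (hj : j ≤ n / 2) :
    ((n / 2).choose j : ℤ) * ∏ i ∈ Finset.range j, (2 * ((n : ℤ) - 2 * i - ((n - 1) % 2 : ℕ)))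
      = cycleMatchingCount n j * ∏ l ∈ Finset.range j, ((n : ℤ) - 1 - l) := by
  have h1 := descFactorial_half_mul_prod n j hn hj
  rw [← factorial_mul_cycleMatchingCount_mul_descFactorial n j (by omega),
    Nat.descFactorial_eq_factorial_mul_choose] at h1
  push_cast [cast_descFactorial_pred n j (by omega)] at h1
  refine mul_left_cancel₀ (Nat.cast_ne_zero.2 j.factorial_ne_zero : (j.factorial : ℤ) ≠ 0) ?_
  push_cast
  linear_combination h1

/-- Alternating sum along a shallow diagonal of Pascal's triangle. -/
def alternatingDiagonalSum (n : ℕ) : ℤ :=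
  ∑ j ∈ Finset.range (n + 1), (-1) ^ j * ((n - j).choose j : ℤ)

lemma alternatingDiagonalSum_eq_sum_range (n N : ℕ) (h1 : n < 2 * N) (h2 : N ≤ n + 1) :
    alternatingDiagonalSum n = ∑ j ∈ Finset.range N, (-1) ^ j * ((n - j).choose j : ℤ) := by
  refine (Finset.sum_subset (Finset.range_mono h2) fun j _ hj => ?_).symm
  have := Finset.mem_range.not.1 hj
  rw [Nat.choose_eq_zero_of_lt (by omega)]
  simp

lemma alternatingDiagonalSum_add_two (n : ℕ) :
    alternatingDiagonalSum (n + 2) = alternatingDiagonalSum (n + 1) - alternatingDiagonalSum n := by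
  rw [alternatingDiagonalSum_eq_sum_range (n + 2) (n + 2) (by omega) (by omega),
    alternatingDiagonalSum, alternatingDiagonalSum, Finset.sum_range_succ',
    Finset.sum_range_succ' _ (n + 1), add_sub_right_comm, ← Finset.sum_sub_distrib]
  congr 1
  refine Finset.sum_congr rfl fun j hj => ?_
  have := Finset.mem_range.1 hj
  rw [show n + 2 - (j + 1) = (n - j) + 1 by omega, show n + 1 - (j + 1) = n - j by omega,
    Nat.choose_succ_succ]
  push_cast
  ring

lemma alternatingDiagonalSum_add_two_sub (p : ℕ) :
    alternatingDiagonalSum (p + 2) - alternatingDiagonalSum p =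
      (if (p + 2) % 6 = 0 then 2
        else if (p + 2) % 6 = 1 ∨ (p + 2) % 6 = 5 then 1
        else if (p + 2) % 6 = 2 ∨ (p + 2) % 6 = 4 then -1
        else -2 : ℤ) := by
  induction p using Nat.twoStepInduction with
  | zero => decide
  | one => decide
  | more p ih1 ih2 =>
    have e1 := alternatingDiagonalSum_add_two (p + 2)
    have e2 := alternatingDiagonalSum_add_two p
    have e : alternatingDiagonalSum (p + 2 + 2) - alternatingDiagonalSum (p + 2) =
        (alternatingDiagonalSum (p + 1 + 2) - alternatingDiagonalSum (p + 1))
        - (alternatingDiagonalSum (p + 2) - alternatingDiagonalSum p) := by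
      rw [show p + 1 + 2 = p + 2 + 1 by ring]
      linear_combination e1 - e2
    rw [e, ih1, ih2]
    split_ifs <;> omega

lemma sum_cycleMatchingCount (p : ℕ) :
    ∑ j ∈ Finset.range ((p + 2) / 2 + 1), (-1) ^ j * (cycleMatchingCount (p + 2) j : ℤ)
      = alternatingDiagonalSum (p + 2) - alternatingDiagonalSum p := by
  rw [alternatingDiagonalSum_eq_sum_range (p + 2) ((p + 2) / 2 + 1) (by omega) (by omega),
    alternatingDiagonalSum_eq_sum_range p ((p + 2) / 2) (by omega) (by omega),
    Finset.sum_range_succ', Finset.sum_range_succ', add_sub_right_comm, ← Finset.sum_sub_distrib]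
  congr 1
  refine Finset.sum_congr rfl fun j _ => ?_
  rw [cycleMatchingCount, show p + 2 - (j + 2) = p - j by omega]
  push_cast
  ring

lemma prod_range_mul_prod_range_sub (n m j a : ℕ) (h : j + a = m) :
    (∏ l ∈ Finset.range j, ((n : ℤ) - 1 - l)) * ∏ i ∈ Finset.range a, ((n : ℤ) - (m - i : ℕ))
      = ∏ l ∈ Finset.Icc 1 m, ((n : ℤ) - l) := by
  have h1 : ∏ l ∈ Finset.Icc 1 m, ((n : ℤ) - l) = ∏ l ∈ Finset.range m, ((n : ℤ) - 1 - l) := by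
    rw [← Finset.Ico_add_one_right_eq_Icc, Finset.prod_Ico_eq_prod_range]
    refine Finset.prod_congr rfl fun l _ => ?_
    push_cast
    ring
  rw [h1, ← h, Finset.prod_range_add, ← Finset.prod_range_reflect _ a]
  congr 1
  refine Finset.prod_congr rfl fun i hi => ?_
  have := Finset.mem_range.1 hi
  omega

theorem omega_mod_six
    (n : ℕ) (hn : 1 ≤ n)
    (U : ℕ → ℕ → ℤ)
    (hU0 : ∀ r, U r 0 = 1)
    (hU : ∀ r k, 1 ≤ k → r + k ≤ n / 2 →
      U r k = ((n : ℤ) - r - k) * U r (k - 1)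
        - 2 * ((n : ℤ) - 2 * r - ((n - 1) % 2 : ℕ)) * U (r + 1) (k - 1)) :
    U 0 (n / 2) =
      (if n % 6 = 0 then 2
        else if n % 6 = 1 ∨ n % 6 = 5 then 1
        else if n % 6 = 2 ∨ n % 6 = 4 then -1
        else -2 : ℤ) * ∏ j ∈ Finset.Icc 1 (n / 2), ((n : ℤ) - j) := by
  obtain rfl | ⟨p, rfl⟩ : n = 1 ∨ ∃ p, n = p + 2 := by
    rcases hn.eq_or_lt with h | h
    · exact Or.inl h.symm
    · exact Or.inr ⟨n - 2, by omega⟩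
  · simp [hU0]
  rw [← alternatingDiagonalSum_add_two_sub, ← sum_cycleMatchingCount]
  generalize hN : p + 2 = n at *
  rw [eq_sum_antidiagonal_choose_of_recurrence (fun s => (n : ℤ) - s)
    (fun r => (-1) * (2 * ((n : ℤ) - 2 * r - ((n - 1) % 2 : ℕ)))) U (n / 2) hU0
    (fun r k h => by
      rw [hU r (k + 1) (by omega) (by omega), Nat.add_sub_cancel]
      push_cast
      ring) (n / 2) 0 (by omega),
    ← Finset.Nat.sum_antidiagonal_eq_sum_range_succ_mk
      (fun q : ℕ × ℕ => (-1) ^ q.1 * (cycleMatchingCount n q.1 : ℤ)), Finset.sum_mul]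
  refine Finset.sum_congr rfl fun q hq => ?_
  have hq' := Finset.HasAntidiagonal.mem_antidiagonal.1 hq
  rw [← prod_range_mul_prod_range_sub n (n / 2) q.1 q.2 hq', Finset.prod_mul_distrib,
    Finset.prod_const, Finset.card_range]
  simp only [zero_add]
  linear_combination (-1) ^ q.1 * (∏ i ∈ Finset.range q.2, ((n : ℤ) - (n / 2 - i : ℕ)))
    * choose_half_mul_prod n q.1 hn (by omega)
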